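/- arXiv:2105.03816 — 7 statements merged into one kernel-verified Lean document; each statement's English description precedes it below -/
import Mathlib

section
/- Let x, y, t be rational numbers with t ≠ 0 and t²y − x ≠ 0, and set a = (x² + t²y²)/(t²y − x), b = xy(t² + 1)/(t²y − x), c = x + y. Then H(a,b,c) = (4txy(x + y)/(t²y − x))²; in particular the Heron product of (a,b,c) is the square of a rational number. -/
/-- The Heron product `H(a,b,c) = (a+b+c)(a+b-c)(b+c-a)(c+a-b)`. -/
def heron (a b c : ℚ) : ℚ :=
  (a + b + c) * (a + b - c) * (b + c - a) * (c + a - b)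

/-- For rationals `x, y, t` with `t ≠ 0` and `t²y - x ≠ 0`, the triple
`a = (x² + t²y²)/(t²y - x)`, `b = xy(t² + 1)/(t²y - x)`, `c = x + y`
has Heron product `(4txy(x+y)/(t²y - x))²`; in particular the Heron product
is the square of a rational number. -/
theorem heron_of_parametrization (x y t a b c : ℚ) (ht : t ≠ 0)
    (hd : t ^ 2 * y - x ≠ 0)
    (ha : a = (x ^ 2 + t ^ 2 * y ^ 2) / (t ^ 2 * y - x))
    (hb : b = x * y * (t ^ 2 + 1) / (t ^ 2 * y - x))
    (hc : c = x + y) :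
    heron a b c = (4 * t * x * y * (x + y) / (t ^ 2 * y - x)) ^ 2 ∧
      ∃ s : ℚ, heron a b c = s ^ 2 := by
  have h : heron a b c = (4 * t * x * y * (x + y) / (t ^ 2 * y - x)) ^ 2 := by
    have h1 : a + b + c = (x + y) * (2 * t ^ 2 * y) / (t ^ 2 * y - x) := by
      rw [ha, hb, hc, eq_div_iff hd, add_mul, add_mul, div_mul_cancel₀ _ hd,
        div_mul_cancel₀ _ hd]
      ring
    have h2 : a + b - c = (x + y) * (2 * x) / (t ^ 2 * y - x) := by
      rw [ha, hb, hc, eq_div_iff hd, sub_mul, add_mul, div_mul_cancel₀ _ hd,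
        div_mul_cancel₀ _ hd]
      ring
    have h3 : a - b = y - x := by
      rw [ha, hb, ← sub_div, div_eq_iff hd]
      ring
    have h4 : b + c - a = 2 * x := by linarith
    have h5 : c + a - b = 2 * y := by linarith
    unfold heron
    rw [h1, h2, h4, h5]
    ring
  exact ⟨h, _, h⟩
end

section
/- Let a, b, c be positive rational numbers satisfying a + b > c, b + c > a, c + a > b, and suppose H(a,b,c) = s² for some nonzero rational s (i.e., (a,b,c) are the sides of a rational triangle). Then there exist nonzero rational numbers x, y, t with t²y − x ≠ 0 such that a = (x² + t²y²)/(t²y − x), b = xy(t² + 1)/(t²y − x), and c = x + y. -/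
/-- Every rational triangle arises from the parametrization: if `a, b, c` are positive
rationals satisfying the strict triangle inequalities and `H(a,b,c) = s²` for some nonzero
rational `s`, then there exist nonzero rationals `x, y, t` with `t²y - x ≠ 0` such that
`a = (x² + t²y²)/(t²y - x)`, `b = xy(t² + 1)/(t²y - x)`, `c = x + y`. -/
theorem rational_triangle_parametrization (a b c : ℚ)
    (hapos : 0 < a) (hbpos : 0 < b) (hcpos : 0 < c)
    (hab : c < a + b) (hbc : a < b + c) (hca : b < c + a)
    (s : ℚ) (hs : s ≠ 0) (hH : heron a b c = s ^ 2) :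
    ∃ x y t : ℚ, x ≠ 0 ∧ y ≠ 0 ∧ t ≠ 0 ∧ t ^ 2 * y - x ≠ 0 ∧
      a = (x ^ 2 + t ^ 2 * y ^ 2) / (t ^ 2 * y - x) ∧
      b = x * y * (t ^ 2 + 1) / (t ^ 2 * y - x) ∧
      c = x + y := by
  unfold heron at hH
  have hp : 0 < a + b - c := by linarith
  have hq : 0 < b + c - a := by linarith
  have hr : 0 < c + a - b := by linarith
  have hT : (s / ((a + b - c) * (c + a - b))) ^ 2
      = (a + b + c) * (b + c - a) / ((a + b - c) * (c + a - b)) := by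
    rw [div_pow, ← hH]
    field_simp
  have hD : (s / ((a + b - c) * (c + a - b))) ^ 2 * ((c + a - b) / 2) - (b + c - a) / 2
      = (b + c - a) * c / (a + b - c) := by
    rw [hT]
    field_simp
    ring
  refine ⟨(b + c - a) / 2, (c + a - b) / 2, s / ((a + b - c) * (c + a - b)),
    by positivity, by positivity, div_ne_zero hs (by positivity), ?_, ?_, ?_, by ring⟩
  · rw [hD]
    positivity
  · rw [hD, hT]
    field_simp
    ring
  · rw [hD, hT]
    field_simp
    ring
end

section
/- With a₁, b₁, c₁, a₂, b₂, c₂ the explicit polynomials in t₁, t₂ defined as follows: E = t₁⁴t₂⁴+3t₁⁴t₂²+4t₁³t₂³+3t₁²t₂⁴+t₁⁴+2t₁³t₂+3t₁²t₂²+2t₁t₂³+t₂⁴, F = 4t₁⁶t₂⁶+5t₁⁶t₂⁴−2t₁⁵t₂⁵+5t₁⁴t₂⁶+3t₁⁶t₂²−2t₁⁵t₂³+2t₁⁴t₂⁴−2t₁³t₂⁵+3t₁²t₂⁶+t₁⁶−2t₁³t₂³+t₂⁶, G = t₁²t₂²+t₁²+t₁t₂+t₂², K = 3t₁⁴t₂⁴+3t₁⁴t₂²+3t₁²t₂⁴+t₁⁴+t₁²t₂²+t₂⁴,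 a₁ = t₁(t₂²+1)EF, b₁ = 2t₁t₂³(t₁²+1)²(t₂²+1)G(3t₁⁵t₂⁴+t₁⁴t₂⁵+3t₁⁵t₂²+t₁⁴t₂³+t₁³t₂⁴−t₁²t₂⁵+t₁⁵+t₁⁴t₂+t₁³t₂²−t₁²t₂³−t₁t₂⁴−t₂⁵), c₁ = t₁(t₁+t₂)(t₂²+1)K(2t₁⁶t₂⁵+2t₁⁶t₂³−t₁⁵t₂⁴+3t₁⁴t₂⁵−3t₁⁵t₂²+t₁⁴t₂³+t₁³t₂⁴+3t₁²t₂⁵−t₁⁵−t₁⁴t₂−t₁³t₂²+t₁²t₂³+t₁t₂⁴+t₂⁵), a₂ = t₂(t₁²+1)EF, b₂ = 2t₁³t₂(t₁²+1)(t₂²+1)²G(t₁⁵t₂⁴+3t₁⁴t₂⁵−t₁⁵t₂²+t₁⁴t₂³+t₁³t₂⁴+3t₁²t₂⁵−t₁⁵−t₁⁴t₂−t₁³t₂²+t₁²t₂³+t₁t₂⁴+t₂⁵), c₂ = t₂(t₁+t₂)(t₁²+1)K(2t₁⁵t₂⁶+3t₁⁵t₂⁴−t₁⁴t₂⁵+2t₁³t₂⁶+3t₁⁵t₂²+t₁⁴t₂³+t₁³t₂⁴−3t₁²t₂⁵+t₁⁵+t₁⁴t₂+t₁³t₂²−t₁²t₂³−t₁t₂⁴+t₂⁵·(−1)):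 then for every pair of rational numbers t₁, t₂, each of H(a₁,b₁,c₁) and H(a₂,b₂,c₂) is the square of a rational number (so both triangles have rational area). -/
set_option maxHeartbeats 1000000

/-- For every pair of rationals `t₁, t₂`, each of the two triples of sides of the paper's
pair of triangles with common circumradius and perimeter has Heron product equal to the
square of a rational number (so both triangles have rational area). -/
theorem common_perimeter_pair_rational_area (t₁ t₂ E F G K a₁ b₁ c₁ a₂ b₂ c₂ : ℚ)
    (hE : E = t₁ ^ 4 * t₂ ^ 4 + 3 * t₁ ^ 4 * t₂ ^ 2 + 4 * t₁ ^ 3 * t₂ ^ 3 +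
      3 * t₁ ^ 2 * t₂ ^ 4 + t₁ ^ 4 + 2 * t₁ ^ 3 * t₂ + 3 * t₁ ^ 2 * t₂ ^ 2 +
      2 * t₁ * t₂ ^ 3 + t₂ ^ 4)
    (hF : F = 4 * t₁ ^ 6 * t₂ ^ 6 + 5 * t₁ ^ 6 * t₂ ^ 4 - 2 * t₁ ^ 5 * t₂ ^ 5 +
      5 * t₁ ^ 4 * t₂ ^ 6 + 3 * t₁ ^ 6 * t₂ ^ 2 - 2 * t₁ ^ 5 * t₂ ^ 3 +
      2 * t₁ ^ 4 * t₂ ^ 4 - 2 * t₁ ^ 3 * t₂ ^ 5 + 3 * t₁ ^ 2 * t₂ ^ 6 + t₁ ^ 6 -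
      2 * t₁ ^ 3 * t₂ ^ 3 + t₂ ^ 6)
    (hG : G = t₁ ^ 2 * t₂ ^ 2 + t₁ ^ 2 + t₁ * t₂ + t₂ ^ 2)
    (hK : K = 3 * t₁ ^ 4 * t₂ ^ 4 + 3 * t₁ ^ 4 * t₂ ^ 2 + 3 * t₁ ^ 2 * t₂ ^ 4 + t₁ ^ 4 +
      t₁ ^ 2 * t₂ ^ 2 + t₂ ^ 4)
    (ha₁ : a₁ = t₁ * (t₂ ^ 2 + 1) * E * F)
    (hb₁ : b₁ = 2 * t₁ * t₂ ^ 3 * (t₁ ^ 2 + 1) ^ 2 * (t₂ ^ 2 + 1) * G *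
      (3 * t₁ ^ 5 * t₂ ^ 4 + t₁ ^ 4 * t₂ ^ 5 + 3 * t₁ ^ 5 * t₂ ^ 2 + t₁ ^ 4 * t₂ ^ 3 +
        t₁ ^ 3 * t₂ ^ 4 - t₁ ^ 2 * t₂ ^ 5 + t₁ ^ 5 + t₁ ^ 4 * t₂ + t₁ ^ 3 * t₂ ^ 2 -
        t₁ ^ 2 * t₂ ^ 3 - t₁ * t₂ ^ 4 - t₂ ^ 5))
    (hc₁ : c₁ = t₁ * (t₁ + t₂) * (t₂ ^ 2 + 1) * K *
      (2 * t₁ ^ 6 * t₂ ^ 5 + 2 * t₁ ^ 6 * t₂ ^ 3 - t₁ ^ 5 * t₂ ^ 4 +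
        3 * t₁ ^ 4 * t₂ ^ 5 - 3 * t₁ ^ 5 * t₂ ^ 2 + t₁ ^ 4 * t₂ ^ 3 + t₁ ^ 3 * t₂ ^ 4 +
        3 * t₁ ^ 2 * t₂ ^ 5 - t₁ ^ 5 - t₁ ^ 4 * t₂ - t₁ ^ 3 * t₂ ^ 2 + t₁ ^ 2 * t₂ ^ 3 +
        t₁ * t₂ ^ 4 + t₂ ^ 5))
    (ha₂ : a₂ = t₂ * (t₁ ^ 2 + 1) * E * F)
    (hb₂ : b₂ = 2 * t₁ ^ 3 * t₂ * (t₁ ^ 2 + 1) * (t₂ ^ 2 + 1) ^ 2 * G *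
      (t₁ ^ 5 * t₂ ^ 4 + 3 * t₁ ^ 4 * t₂ ^ 5 - t₁ ^ 5 * t₂ ^ 2 + t₁ ^ 4 * t₂ ^ 3 +
        t₁ ^ 3 * t₂ ^ 4 + 3 * t₁ ^ 2 * t₂ ^ 5 - t₁ ^ 5 - t₁ ^ 4 * t₂ - t₁ ^ 3 * t₂ ^ 2 +
        t₁ ^ 2 * t₂ ^ 3 + t₁ * t₂ ^ 4 + t₂ ^ 5))
    (hc₂ : c₂ = t₂ * (t₁ + t₂) * (t₁ ^ 2 + 1) * K *
      (2 * t₁ ^ 5 * t₂ ^ 6 + 3 * t₁ ^ 5 * t₂ ^ 4 - t₁ ^ 4 * t₂ ^ 5 +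
        2 * t₁ ^ 3 * t₂ ^ 6 + 3 * t₁ ^ 5 * t₂ ^ 2 + t₁ ^ 4 * t₂ ^ 3 + t₁ ^ 3 * t₂ ^ 4 -
        3 * t₁ ^ 2 * t₂ ^ 5 + t₁ ^ 5 + t₁ ^ 4 * t₂ + t₁ ^ 3 * t₂ ^ 2 - t₁ ^ 2 * t₂ ^ 3 -
        t₁ * t₂ ^ 4 - t₂ ^ 5))
    :
    (∃ s₁ : ℚ, heron a₁ b₁ c₁ = s₁ ^ 2) ∧ (∃ s₂ : ℚ, heron a₂ b₂ c₂ = s₂ ^ 2) := by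
  constructor
  · obtain ⟨P, hP⟩ : ∃ P : ℚ, P = (3 * t₁ ^ 5 * t₂ ^ 4 + t₁ ^ 4 * t₂ ^ 5 + 3 * t₁ ^ 5 * t₂ ^ 2 + t₁ ^ 4 * t₂ ^ 3 +
        t₁ ^ 3 * t₂ ^ 4 - t₁ ^ 2 * t₂ ^ 5 + t₁ ^ 5 + t₁ ^ 4 * t₂ + t₁ ^ 3 * t₂ ^ 2 -
        t₁ ^ 2 * t₂ ^ 3 - t₁ * t₂ ^ 4 - t₂ ^ 5) := ⟨_, rfl⟩
    obtain ⟨Q, hQ⟩ : ∃ Q : ℚ, Q = (2 * t₁ ^ 6 * t₂ ^ 5 + 2 * t₁ ^ 6 * t₂ ^ 3 - t₁ ^ 5 * t₂ ^ 4 +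
        3 * t₁ ^ 4 * t₂ ^ 5 - 3 * t₁ ^ 5 * t₂ ^ 2 + t₁ ^ 4 * t₂ ^ 3 + t₁ ^ 3 * t₂ ^ 4 +
        3 * t₁ ^ 2 * t₂ ^ 5 - t₁ ^ 5 - t₁ ^ 4 * t₂ - t₁ ^ 3 * t₂ ^ 2 + t₁ ^ 2 * t₂ ^ 3 +
        t₁ * t₂ ^ 4 + t₂ ^ 5) := ⟨_, rfl⟩
    rw [← hP] at hb₁
    rw [← hQ] at hc₁
    have h0 : a₁ + b₁ + c₁ = 4 * t₁ ^ 3 * t₂ ^ 3 * (t₁ ^ 2 + 1) * (t₂ ^ 2 + 1) * (t₁ + t₂) * G * K := by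
      rw [ha₁, hb₁, hc₁, hP, hQ, hE, hF, hG, hK]; ring
    have h1 : a₁ + b₁ - c₁ = 2 * t₁ * (t₂ ^ 2 + 1) * (t₁ + t₂) * K * P := by
      rw [ha₁, hb₁, hc₁, hP, hQ, hE, hF, hG, hK]; ring
    have h2 : b₁ + c₁ - a₁ = 2 * t₁ * (t₂ ^ 2 + 1) * P * Q := by
      rw [ha₁, hb₁, hc₁, hP, hQ, hE, hF]; rw [hG, hK]; ring
    have h3 : c₁ + a₁ - b₁ = 4 * t₁ * t₂ ^ 3 * (t₁ ^ 2 + 1) * (t₂ ^ 2 + 1) * G * Q := by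
      rw [ha₁, hb₁, hc₁, hP, hQ, hE, hF, hG, hK]; ring
    refine ⟨8 * t₁ ^ 3 * t₂ ^ 3 * (t₁ ^ 2 + 1) * (t₂ ^ 2 + 1) * (t₂ ^ 2 + 1) * (t₁ + t₂) * G * K * P * Q, ?_⟩
    unfold heron
    rw [h0, h1, h2, h3]
    clear * -
    generalize (t₁ ^ 2 + 1) = X
    generalize (t₂ ^ 2 + 1) = Y
    generalize (t₁ + t₂) = S
    ring
  · obtain ⟨P, hP⟩ : ∃ P : ℚ, P = (t₁ ^ 5 * t₂ ^ 4 + 3 * t₁ ^ 4 * t₂ ^ 5 - t₁ ^ 5 * t₂ ^ 2 + t₁ ^ 4 * t₂ ^ 3 +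
        t₁ ^ 3 * t₂ ^ 4 + 3 * t₁ ^ 2 * t₂ ^ 5 - t₁ ^ 5 - t₁ ^ 4 * t₂ - t₁ ^ 3 * t₂ ^ 2 +
        t₁ ^ 2 * t₂ ^ 3 + t₁ * t₂ ^ 4 + t₂ ^ 5) := ⟨_, rfl⟩
    obtain ⟨Q, hQ⟩ : ∃ Q : ℚ, Q = (2 * t₁ ^ 5 * t₂ ^ 6 + 3 * t₁ ^ 5 * t₂ ^ 4 - t₁ ^ 4 * t₂ ^ 5 +
        2 * t₁ ^ 3 * t₂ ^ 6 + 3 * t₁ ^ 5 * t₂ ^ 2 + t₁ ^ 4 * t₂ ^ 3 + t₁ ^ 3 * t₂ ^ 4 -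
        3 * t₁ ^ 2 * t₂ ^ 5 + t₁ ^ 5 + t₁ ^ 4 * t₂ + t₁ ^ 3 * t₂ ^ 2 - t₁ ^ 2 * t₂ ^ 3 -
        t₁ * t₂ ^ 4 - t₂ ^ 5) := ⟨_, rfl⟩
    rw [← hP] at hb₂
    rw [← hQ] at hc₂
    have h0 : a₂ + b₂ + c₂ = 4 * t₁ ^ 3 * t₂ ^ 3 * (t₁ ^ 2 + 1) * (t₂ ^ 2 + 1) * (t₁ + t₂) * G * K := by
      rw [ha₂, hb₂, hc₂, hP, hQ, hE, hF, hG, hK]; ring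
    have h1 : a₂ + b₂ - c₂ = 2 * t₂ * (t₁ ^ 2 + 1) * (t₁ + t₂) * K * P := by
      rw [ha₂, hb₂, hc₂, hP, hQ, hE, hF, hG, hK]; ring
    have h2 : b₂ + c₂ - a₂ = 2 * t₂ * (t₁ ^ 2 + 1) * P * Q := by
      rw [ha₂, hb₂, hc₂, hP, hQ, hE, hF]; rw [hG, hK]; ring
    have h3 : c₂ + a₂ - b₂ = 4 * t₂ * t₁ ^ 3 * (t₁ ^ 2 + 1) * (t₂ ^ 2 + 1) * G * Q := by
      rw [ha₂, hb₂, hc₂, hP, hQ, hE, hF, hG, hK]; ring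
    refine ⟨8 * t₁ ^ 3 * t₂ ^ 3 * (t₁ ^ 2 + 1) * (t₂ ^ 2 + 1) * (t₁ ^ 2 + 1) * (t₁ + t₂) * G * K * P * Q, ?_⟩
    unfold heron
    rw [h0, h1, h2, h3]
    clear * -
    generalize (t₁ ^ 2 + 1) = X
    generalize (t₂ ^ 2 + 1) = Y
    generalize (t₁ + t₂) = S
    ring
end

section
/- With a₁, b₁, c₁, a₂, b₂, c₂ the explicit polynomial sides of the paper's pair of triangles with common circumradius and perimeter, namely (using E, F, G, K as follows: E = t₁⁴t₂⁴+3t₁⁴t₂²+4t₁³t₂³+3t₁²t₂⁴+t₁⁴+2t₁³t₂+3t₁²t₂²+2t₁t₂³+t₂⁴, F = 4t₁⁶t₂⁶+5t₁⁶t₂⁴−2t₁⁵t₂⁵+5t₁⁴t₂⁶+3t₁⁶t₂²−2t₁⁵t₂³+2t₁⁴t₂⁴−2t₁³t₂⁵+3t₁²t₂⁶+t₁⁶−2t₁³t₂³+t₂⁶, G = t₁²t₂²+t₁²+t₁t₂+t₂², K = 3t₁⁴t₂⁴+3t₁⁴t₂²+3t₁²t₂⁴+t₁⁴+t₁²t₂²+t₂⁴)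 a₁ = t₁(t₂²+1)EF, b₁ = 2t₁t₂³(t₁²+1)²(t₂²+1)G(3t₁⁵t₂⁴+t₁⁴t₂⁵+3t₁⁵t₂²+t₁⁴t₂³+t₁³t₂⁴−t₁²t₂⁵+t₁⁵+t₁⁴t₂+t₁³t₂²−t₁²t₂³−t₁t₂⁴−t₂⁵), c₁ = t₁(t₁+t₂)(t₂²+1)K(2t₁⁶t₂⁵+2t₁⁶t₂³−t₁⁵t₂⁴+3t₁⁴t₂⁵−3t₁⁵t₂²+t₁⁴t₂³+t₁³t₂⁴+3t₁²t₂⁵−t₁⁵−t₁⁴t₂−t₁³t₂²+t₁²t₂³+t₁t₂⁴+t₂⁵), a₂ = t₂(t₁²+1)EF, b₂ = 2t₁³t₂(t₁²+1)(t₂²+1)²G(t₁⁵t₂⁴+3t₁⁴t₂⁵−t₁⁵t₂²+t₁⁴t₂³+t₁³t₂⁴+3t₁²t₂⁵−t₁⁵−t₁⁴t₂−t₁³t₂²+t₁²t₂³+t₁t₂⁴+t₂⁵), c₂ = t₂(t₁+t₂)(t₁²+1)K(2t₁⁵t₂⁶+3t₁⁵t₂⁴−t₁⁴t₂⁵+2t₁³t₂⁶+3t₁⁵t₂²+t₁⁴t₂³+t₁³t₂⁴−3t₁²t₂⁵+t₁⁵+t₁⁴t₂+t₁³t₂²−t₁²t₂³−t₁t₂⁴−t₂⁵):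 the polynomial identity 16·(aᵢbᵢcᵢ)² = [(t₁²+1)(t₂²+1)·E·F]²·H(aᵢ,bᵢ,cᵢ) holds in ℚ[t₁,t₂] for both i = 1 and i = 2; consequently both triangles have the common circumradius (t₁²+1)(t₂²+1)EF/4. -/
set_option maxHeartbeats 0

theorem fin_aux (t a b c s m : ℚ) (hs : s ^ 2 = 1)
    (h : (1 + t ^ 2) * (b ^ 2 + c ^ 2 - a ^ 2) = s * 2 * b * c * (1 - t ^ 2)) :
    16 * ((m * t * a) * (m * t * b) * (m * t * c)) ^ 2 =
      ((t ^ 2 + 1) * m * a) ^ 2 * heron (m * t * a) (m * t * b) (m * t * c) := by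
  have h2 : (1 + t ^ 2) ^ 2 * (b ^ 2 + c ^ 2 - a ^ 2) ^ 2 = 4 * b ^ 2 * c ^ 2 * (1 - t ^ 2) ^ 2 := by
    rw [← mul_pow, h]; linear_combination (2 * b * c * (1 - t ^ 2)) ^ 2 * hs
  unfold heron
  linear_combination (m ^ 6 * t ^ 4 * a ^ 2) * h2

theorem core1 (t₁ t₂ : ℚ) :
    (1 + t₁ ^ 2) * ((2 * t₂ ^ 3 * (t₁ ^ 2 + 1) ^ 2 * (t₁ ^ 2 * t₂ ^ 2 + t₁ ^ 2 + t₁ * t₂ +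
        t₂ ^ 2) * (3 * t₁ ^ 5 * t₂ ^ 4 + t₁ ^ 4 * t₂ ^ 5 + 3 * t₁ ^ 5 * t₂ ^ 2 + t₁ ^ 4 * t₂ ^ 3 +
        t₁ ^ 3 * t₂ ^ 4 - t₁ ^ 2 * t₂ ^ 5 + t₁ ^ 5 + t₁ ^ 4 * t₂ + t₁ ^ 3 * t₂ ^ 2 - t₁ ^ 2 * t₂ ^
        3 - t₁ * t₂ ^ 4 - t₂ ^ 5)) ^ 2 +
     ((t₁ + t₂) * (3 * t₁ ^ 4 * t₂ ^ 4 + 3 * t₁ ^ 4 * t₂ ^ 2 + 3 * t₁ ^ 2 * t₂ ^ 4 + t₁ ^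
         4 + t₁ ^ 2 * t₂ ^ 2 + t₂ ^ 4) * (2 * t₁ ^ 6 * t₂ ^ 5 + 2 * t₁ ^ 6 * t₂ ^ 3 - t₁ ^ 5 * t₂ ^
         4 + 3 * t₁ ^ 4 * t₂ ^ 5 - 3 * t₁ ^ 5 * t₂ ^ 2 + t₁ ^ 4 * t₂ ^ 3 + t₁ ^ 3 * t₂ ^ 4 + 3 * t₁
         ^ 2 * t₂ ^ 5 - t₁ ^ 5 - t₁ ^ 4 * t₂ - t₁ ^ 3 * t₂ ^ 2 + t₁ ^ 2 * t₂ ^ 3 + t₁ * t₂ ^ 4 + t₂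
         ^ 5)) ^ 2 -
     ((t₁ ^ 4 * t₂ ^ 4 + 3 * t₁ ^ 4 * t₂ ^ 2 + 4 * t₁ ^ 3 * t₂ ^ 3 + 3 * t₁ ^ 2 * t₂ ^ 4 +
         t₁ ^ 4 + 2 * t₁ ^ 3 * t₂ + 3 * t₁ ^ 2 * t₂ ^ 2 + 2 * t₁ * t₂ ^ 3 + t₂ ^ 4) * (4 * t₁ ^ 6 *
         t₂ ^ 6 + 5 * t₁ ^ 6 * t₂ ^ 4 - 2 * t₁ ^ 5 * t₂ ^ 5 + 5 * t₁ ^ 4 * t₂ ^ 6 + 3 * t₁ ^ 6 * t₂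
         ^ 2 - 2 * t₁ ^ 5 * t₂ ^ 3 + 2 * t₁ ^ 4 * t₂ ^ 4 - 2 * t₁ ^ 3 * t₂ ^ 5 + 3 * t₁ ^ 2 * t₂ ^
         6 + t₁ ^ 6 - 2 * t₁ ^ 3 * t₂ ^ 3 + t₂ ^ 6)) ^ 2) =
    (-1) * 2 * (2 * t₂ ^ 3 * (t₁ ^ 2 + 1) ^ 2 * (t₁ ^ 2 * t₂ ^ 2 + t₁ ^ 2 + t₁ * t₂ + t₂ ^
        2) * (3 * t₁ ^ 5 * t₂ ^ 4 + t₁ ^ 4 * t₂ ^ 5 + 3 * t₁ ^ 5 * t₂ ^ 2 + t₁ ^ 4 * t₂ ^ 3 + t₁ ^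
        3 * t₂ ^ 4 - t₁ ^ 2 * t₂ ^ 5 + t₁ ^ 5 + t₁ ^ 4 * t₂ + t₁ ^ 3 * t₂ ^ 2 - t₁ ^ 2 * t₂ ^ 3 -
        t₁ * t₂ ^ 4 - t₂ ^ 5)) *
     ((t₁ + t₂) * (3 * t₁ ^ 4 * t₂ ^ 4 + 3 * t₁ ^ 4 * t₂ ^ 2 + 3 * t₁ ^ 2 * t₂ ^ 4 + t₁ ^
         4 + t₁ ^ 2 * t₂ ^ 2 + t₂ ^ 4) * (2 * t₁ ^ 6 * t₂ ^ 5 + 2 * t₁ ^ 6 * t₂ ^ 3 - t₁ ^ 5 * t₂ ^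
         4 + 3 * t₁ ^ 4 * t₂ ^ 5 - 3 * t₁ ^ 5 * t₂ ^ 2 + t₁ ^ 4 * t₂ ^ 3 + t₁ ^ 3 * t₂ ^ 4 + 3 * t₁
         ^ 2 * t₂ ^ 5 - t₁ ^ 5 - t₁ ^ 4 * t₂ - t₁ ^ 3 * t₂ ^ 2 + t₁ ^ 2 * t₂ ^ 3 + t₁ * t₂ ^ 4 + t₂
         ^ 5)) * (1 - t₁ ^ 2) := by
  ring

theorem core2 (t₁ t₂ : ℚ) :
    (1 + t₂ ^ 2) * ((2 * t₁ ^ 3 * (t₂ ^ 2 + 1) ^ 2 * (t₁ ^ 2 * t₂ ^ 2 + t₁ ^ 2 + t₁ * t₂ +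
        t₂ ^ 2) * (t₁ ^ 5 * t₂ ^ 4 + 3 * t₁ ^ 4 * t₂ ^ 5 - t₁ ^ 5 * t₂ ^ 2 + t₁ ^ 4 * t₂ ^ 3 + t₁
        ^ 3 * t₂ ^ 4 + 3 * t₁ ^ 2 * t₂ ^ 5 - t₁ ^ 5 - t₁ ^ 4 * t₂ - t₁ ^ 3 * t₂ ^ 2 + t₁ ^ 2 * t₂
        ^ 3 + t₁ * t₂ ^ 4 + t₂ ^ 5)) ^ 2 +
     ((t₁ + t₂) * (3 * t₁ ^ 4 * t₂ ^ 4 + 3 * t₁ ^ 4 * t₂ ^ 2 + 3 * t₁ ^ 2 * t₂ ^ 4 + t₁ ^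
         4 + t₁ ^ 2 * t₂ ^ 2 + t₂ ^ 4) * (2 * t₁ ^ 5 * t₂ ^ 6 + 3 * t₁ ^ 5 * t₂ ^ 4 - t₁ ^ 4 * t₂ ^
         5 + 2 * t₁ ^ 3 * t₂ ^ 6 + 3 * t₁ ^ 5 * t₂ ^ 2 + t₁ ^ 4 * t₂ ^ 3 + t₁ ^ 3 * t₂ ^ 4 - 3 * t₁
         ^ 2 * t₂ ^ 5 + t₁ ^ 5 + t₁ ^ 4 * t₂ + t₁ ^ 3 * t₂ ^ 2 - t₁ ^ 2 * t₂ ^ 3 - t₁ * t₂ ^ 4 - t₂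
         ^ 5)) ^ 2 -
     ((t₁ ^ 4 * t₂ ^ 4 + 3 * t₁ ^ 4 * t₂ ^ 2 + 4 * t₁ ^ 3 * t₂ ^ 3 + 3 * t₁ ^ 2 * t₂ ^ 4 +
         t₁ ^ 4 + 2 * t₁ ^ 3 * t₂ + 3 * t₁ ^ 2 * t₂ ^ 2 + 2 * t₁ * t₂ ^ 3 + t₂ ^ 4) * (4 * t₁ ^ 6 *
         t₂ ^ 6 + 5 * t₁ ^ 6 * t₂ ^ 4 - 2 * t₁ ^ 5 * t₂ ^ 5 + 5 * t₁ ^ 4 * t₂ ^ 6 + 3 * t₁ ^ 6 * t₂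
         ^ 2 - 2 * t₁ ^ 5 * t₂ ^ 3 + 2 * t₁ ^ 4 * t₂ ^ 4 - 2 * t₁ ^ 3 * t₂ ^ 5 + 3 * t₁ ^ 2 * t₂ ^
         6 + t₁ ^ 6 - 2 * t₁ ^ 3 * t₂ ^ 3 + t₂ ^ 6)) ^ 2) =
    (-1) * 2 * (2 * t₁ ^ 3 * (t₂ ^ 2 + 1) ^ 2 * (t₁ ^ 2 * t₂ ^ 2 + t₁ ^ 2 + t₁ * t₂ + t₂ ^
        2) * (t₁ ^ 5 * t₂ ^ 4 + 3 * t₁ ^ 4 * t₂ ^ 5 - t₁ ^ 5 * t₂ ^ 2 + t₁ ^ 4 * t₂ ^ 3 + t₁ ^ 3 *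
        t₂ ^ 4 + 3 * t₁ ^ 2 * t₂ ^ 5 - t₁ ^ 5 - t₁ ^ 4 * t₂ - t₁ ^ 3 * t₂ ^ 2 + t₁ ^ 2 * t₂ ^ 3 +
        t₁ * t₂ ^ 4 + t₂ ^ 5)) *
     ((t₁ + t₂) * (3 * t₁ ^ 4 * t₂ ^ 4 + 3 * t₁ ^ 4 * t₂ ^ 2 + 3 * t₁ ^ 2 * t₂ ^ 4 + t₁ ^
         4 + t₁ ^ 2 * t₂ ^ 2 + t₂ ^ 4) * (2 * t₁ ^ 5 * t₂ ^ 6 + 3 * t₁ ^ 5 * t₂ ^ 4 - t₁ ^ 4 * t₂ ^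
         5 + 2 * t₁ ^ 3 * t₂ ^ 6 + 3 * t₁ ^ 5 * t₂ ^ 2 + t₁ ^ 4 * t₂ ^ 3 + t₁ ^ 3 * t₂ ^ 4 - 3 * t₁
         ^ 2 * t₂ ^ 5 + t₁ ^ 5 + t₁ ^ 4 * t₂ + t₁ ^ 3 * t₂ ^ 2 - t₁ ^ 2 * t₂ ^ 3 - t₁ * t₂ ^ 4 - t₂
         ^ 5)) * (1 - t₂ ^ 2) := by
  ring

/-- For the paper's pair of triangles with common circumradius and perimeter, the
identity `16·(aᵢbᵢcᵢ)² = ((t₁²+1)(t₂²+1)·E·F)²·H(aᵢ,bᵢ,cᵢ)` holds for `i = 1, 2`;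
consequently both triangles have the common circumradius `(t₁²+1)(t₂²+1)EF/4`. -/
theorem common_circumradius_pair_perimeter (t₁ t₂ E F G K a₁ b₁ c₁ a₂ b₂ c₂ : ℚ)
    (hE : E = t₁ ^ 4 * t₂ ^ 4 + 3 * t₁ ^ 4 * t₂ ^ 2 + 4 * t₁ ^ 3 * t₂ ^ 3 +
      3 * t₁ ^ 2 * t₂ ^ 4 + t₁ ^ 4 + 2 * t₁ ^ 3 * t₂ + 3 * t₁ ^ 2 * t₂ ^ 2 +
      2 * t₁ * t₂ ^ 3 + t₂ ^ 4)
    (hF : F = 4 * t₁ ^ 6 * t₂ ^ 6 + 5 * t₁ ^ 6 * t₂ ^ 4 - 2 * t₁ ^ 5 * t₂ ^ 5 +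
      5 * t₁ ^ 4 * t₂ ^ 6 + 3 * t₁ ^ 6 * t₂ ^ 2 - 2 * t₁ ^ 5 * t₂ ^ 3 +
      2 * t₁ ^ 4 * t₂ ^ 4 - 2 * t₁ ^ 3 * t₂ ^ 5 + 3 * t₁ ^ 2 * t₂ ^ 6 + t₁ ^ 6 -
      2 * t₁ ^ 3 * t₂ ^ 3 + t₂ ^ 6)
    (hG : G = t₁ ^ 2 * t₂ ^ 2 + t₁ ^ 2 + t₁ * t₂ + t₂ ^ 2)
    (hK : K = 3 * t₁ ^ 4 * t₂ ^ 4 + 3 * t₁ ^ 4 * t₂ ^ 2 + 3 * t₁ ^ 2 * t₂ ^ 4 + t₁ ^ 4 +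
      t₁ ^ 2 * t₂ ^ 2 + t₂ ^ 4)
    (ha₁ : a₁ = t₁ * (t₂ ^ 2 + 1) * E * F)
    (hb₁ : b₁ = 2 * t₁ * t₂ ^ 3 * (t₁ ^ 2 + 1) ^ 2 * (t₂ ^ 2 + 1) * G *
      (3 * t₁ ^ 5 * t₂ ^ 4 + t₁ ^ 4 * t₂ ^ 5 + 3 * t₁ ^ 5 * t₂ ^ 2 + t₁ ^ 4 * t₂ ^ 3 +
        t₁ ^ 3 * t₂ ^ 4 - t₁ ^ 2 * t₂ ^ 5 + t₁ ^ 5 + t₁ ^ 4 * t₂ + t₁ ^ 3 * t₂ ^ 2 -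
        t₁ ^ 2 * t₂ ^ 3 - t₁ * t₂ ^ 4 - t₂ ^ 5))
    (hc₁ : c₁ = t₁ * (t₁ + t₂) * (t₂ ^ 2 + 1) * K *
      (2 * t₁ ^ 6 * t₂ ^ 5 + 2 * t₁ ^ 6 * t₂ ^ 3 - t₁ ^ 5 * t₂ ^ 4 +
        3 * t₁ ^ 4 * t₂ ^ 5 - 3 * t₁ ^ 5 * t₂ ^ 2 + t₁ ^ 4 * t₂ ^ 3 + t₁ ^ 3 * t₂ ^ 4 +
        3 * t₁ ^ 2 * t₂ ^ 5 - t₁ ^ 5 - t₁ ^ 4 * t₂ - t₁ ^ 3 * t₂ ^ 2 + t₁ ^ 2 * t₂ ^ 3 +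
        t₁ * t₂ ^ 4 + t₂ ^ 5))
    (ha₂ : a₂ = t₂ * (t₁ ^ 2 + 1) * E * F)
    (hb₂ : b₂ = 2 * t₁ ^ 3 * t₂ * (t₁ ^ 2 + 1) * (t₂ ^ 2 + 1) ^ 2 * G *
      (t₁ ^ 5 * t₂ ^ 4 + 3 * t₁ ^ 4 * t₂ ^ 5 - t₁ ^ 5 * t₂ ^ 2 + t₁ ^ 4 * t₂ ^ 3 +
        t₁ ^ 3 * t₂ ^ 4 + 3 * t₁ ^ 2 * t₂ ^ 5 - t₁ ^ 5 - t₁ ^ 4 * t₂ - t₁ ^ 3 * t₂ ^ 2 +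
        t₁ ^ 2 * t₂ ^ 3 + t₁ * t₂ ^ 4 + t₂ ^ 5))
    (hc₂ : c₂ = t₂ * (t₁ + t₂) * (t₁ ^ 2 + 1) * K *
      (2 * t₁ ^ 5 * t₂ ^ 6 + 3 * t₁ ^ 5 * t₂ ^ 4 - t₁ ^ 4 * t₂ ^ 5 +
        2 * t₁ ^ 3 * t₂ ^ 6 + 3 * t₁ ^ 5 * t₂ ^ 2 + t₁ ^ 4 * t₂ ^ 3 + t₁ ^ 3 * t₂ ^ 4 -
        3 * t₁ ^ 2 * t₂ ^ 5 + t₁ ^ 5 + t₁ ^ 4 * t₂ + t₁ ^ 3 * t₂ ^ 2 - t₁ ^ 2 * t₂ ^ 3 -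
        t₁ * t₂ ^ 4 - t₂ ^ 5))
    :
    16 * (a₁ * b₁ * c₁) ^ 2 =
      ((t₁ ^ 2 + 1) * (t₂ ^ 2 + 1) * E * F) ^ 2 * heron a₁ b₁ c₁ ∧
    16 * (a₂ * b₂ * c₂) ^ 2 =
      ((t₁ ^ 2 + 1) * (t₂ ^ 2 + 1) * E * F) ^ 2 * heron a₂ b₂ c₂ := by
  
  constructor
  · have h := core1 t₁ t₂
    rw [← hE, ← hF, ← hG, ← hK] at h
    have h' := fin_aux t₁ (E * F) _ _ (-1) (t₂ ^ 2 + 1) (by norm_num) h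
    have ea : a₁ = (t₂ ^ 2 + 1) * t₁ * (E * F) := by rw [ha₁]; ring
    have eb : b₁ = (t₂ ^ 2 + 1) * t₁ * (2 * t₂ ^ 3 * (t₁ ^ 2 + 1) ^ 2 * G * (3 * t₁ ^ 5 *
        t₂ ^ 4 + t₁ ^ 4 * t₂ ^ 5 + 3 * t₁ ^ 5 * t₂ ^ 2 + t₁ ^ 4 * t₂ ^ 3 + t₁ ^ 3 * t₂ ^ 4 - t₁ ^
        2 * t₂ ^ 5 + t₁ ^ 5 + t₁ ^ 4 * t₂ + t₁ ^ 3 * t₂ ^ 2 - t₁ ^ 2 * t₂ ^ 3 - t₁ * t₂ ^ 4 - t₂ ^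
        5)) := by rw [hb₁]; ring
    have ec : c₁ = (t₂ ^ 2 + 1) * t₁ * ((t₁ + t₂) * K * (2 * t₁ ^ 6 * t₂ ^ 5 + 2 * t₁ ^ 6
        * t₂ ^ 3 - t₁ ^ 5 * t₂ ^ 4 + 3 * t₁ ^ 4 * t₂ ^ 5 - 3 * t₁ ^ 5 * t₂ ^ 2 + t₁ ^ 4 * t₂ ^ 3 +
        t₁ ^ 3 * t₂ ^ 4 + 3 * t₁ ^ 2 * t₂ ^ 5 - t₁ ^ 5 - t₁ ^ 4 * t₂ - t₁ ^ 3 * t₂ ^ 2 + t₁ ^ 2 *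
        t₂ ^ 3 + t₁ * t₂ ^ 4 + t₂ ^ 5)) := by rw [hc₁]; ring
    rw [← ea, ← eb, ← ec] at h'
    rw [h']; ring
  · have h := core2 t₁ t₂
    rw [← hE, ← hF, ← hG, ← hK] at h
    have h' := fin_aux t₂ (E * F) _ _ (-1) (t₁ ^ 2 + 1) (by norm_num) h
    have ea : a₂ = (t₁ ^ 2 + 1) * t₂ * (E * F) := by rw [ha₂]; ring
    have eb : b₂ = (t₁ ^ 2 + 1) * t₂ * (2 * t₁ ^ 3 * (t₂ ^ 2 + 1) ^ 2 * G * (t₁ ^ 5 * t₂ ^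
        4 + 3 * t₁ ^ 4 * t₂ ^ 5 - t₁ ^ 5 * t₂ ^ 2 + t₁ ^ 4 * t₂ ^ 3 + t₁ ^ 3 * t₂ ^ 4 + 3 * t₁ ^ 2
        * t₂ ^ 5 - t₁ ^ 5 - t₁ ^ 4 * t₂ - t₁ ^ 3 * t₂ ^ 2 + t₁ ^ 2 * t₂ ^ 3 + t₁ * t₂ ^ 4 + t₂ ^
        5)) := by rw [hb₂]; ring
    have ec : c₂ = (t₁ ^ 2 + 1) * t₂ * ((t₁ + t₂) * K * (2 * t₁ ^ 5 * t₂ ^ 6 + 3 * t₁ ^ 5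
        * t₂ ^ 4 - t₁ ^ 4 * t₂ ^ 5 + 2 * t₁ ^ 3 * t₂ ^ 6 + 3 * t₁ ^ 5 * t₂ ^ 2 + t₁ ^ 4 * t₂ ^ 3 +
        t₁ ^ 3 * t₂ ^ 4 - 3 * t₁ ^ 2 * t₂ ^ 5 + t₁ ^ 5 + t₁ ^ 4 * t₂ + t₁ ^ 3 * t₂ ^ 2 - t₁ ^ 2 *
        t₂ ^ 3 - t₁ * t₂ ^ 4 - t₂ ^ 5)) := by rw [hc₂]; ring
    rw [← ea, ← eb, ← ec] at h'
    rw [h']; ring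
end

section
/- Let t₁ be a rational number with t₁ > 2 and t₁² > 2t₁ + 1 (i.e., t₁ > 1 + √2). Define a₁ = 2t₁(t₁²−4t₁+5), b₁ = 2(t₁²+1)(t₁−2), c₁ = 4(t₁−1)(t₁²−2t₁−1), and a₂ = (t₁²+1)(t₁²−4t₁+5), b₂ = (t₁²−2t₁−1)(t₁²−2t₁+3), c₂ = 4(t₁−1)². Then (a₁,b₁,c₁) and (a₂,b₂,c₂) are each the sides of a genuine triangle (all sides positive and the strict triangle inequalities hold), both triangles have rational area, they have the same circumradius (t₁²+1)(t₁²−4t₁+5)/2 and the same inradius 2(t₁²−2t₁−1), and the second triangle is right-angled, i.e., a₂² = b₂² + c₂². -/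
/-- For rational `t₁` with `t₁ > 2` and `t₁² > 2t₁ + 1`, the two explicitly given triples
are each the sides of a genuine triangle, both triangles have rational area, they have the
same circumradius `(t₁²+1)(t₁²-4t₁+5)/2` and the same inradius `2(t₁²-2t₁-1)`, and the
second triangle is right-angled with hypotenuse `a₂`. -/
theorem right_triangle_common_circumradius_inradius (t₁ a₁ b₁ c₁ a₂ b₂ c₂ : ℚ)
    (ht : 2 < t₁) (ht' : 2 * t₁ + 1 < t₁ ^ 2)
    (ha₁ : a₁ = 2 * t₁ * (t₁ ^ 2 - 4 * t₁ + 5))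
    (hb₁ : b₁ = 2 * (t₁ ^ 2 + 1) * (t₁ - 2))
    (hc₁ : c₁ = 4 * (t₁ - 1) * (t₁ ^ 2 - 2 * t₁ - 1))
    (ha₂ : a₂ = (t₁ ^ 2 + 1) * (t₁ ^ 2 - 4 * t₁ + 5))
    (hb₂ : b₂ = (t₁ ^ 2 - 2 * t₁ - 1) * (t₁ ^ 2 - 2 * t₁ + 3))
    (hc₂ : c₂ = 4 * (t₁ - 1) ^ 2) :
    (0 < a₁ ∧ 0 < b₁ ∧ 0 < c₁ ∧ c₁ < a₁ + b₁ ∧ a₁ < b₁ + c₁ ∧ b₁ < c₁ + a₁) ∧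
    (0 < a₂ ∧ 0 < b₂ ∧ 0 < c₂ ∧ c₂ < a₂ + b₂ ∧ a₂ < b₂ + c₂ ∧ b₂ < c₂ + a₂) ∧
    (∃ s₁ : ℚ, heron a₁ b₁ c₁ = s₁ ^ 2) ∧ (∃ s₂ : ℚ, heron a₂ b₂ c₂ = s₂ ^ 2) ∧
    4 * (a₁ * b₁ * c₁) ^ 2 =
      ((t₁ ^ 2 + 1) * (t₁ ^ 2 - 4 * t₁ + 5)) ^ 2 * heron a₁ b₁ c₁ ∧
    4 * (a₂ * b₂ * c₂) ^ 2 =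
      ((t₁ ^ 2 + 1) * (t₁ ^ 2 - 4 * t₁ + 5)) ^ 2 * heron a₂ b₂ c₂ ∧
    heron a₁ b₁ c₁ =
      4 * (a₁ + b₁ + c₁) ^ 2 * (2 * (t₁ ^ 2 - 2 * t₁ - 1)) ^ 2 ∧
    heron a₂ b₂ c₂ =
      4 * (a₂ + b₂ + c₂) ^ 2 * (2 * (t₁ ^ 2 - 2 * t₁ - 1)) ^ 2 ∧
    a₂ ^ 2 = b₂ ^ 2 + c₂ ^ 2 := by
  have hq : 0 < t₁ ^ 2 - 2 * t₁ - 1 := by linarith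
  have hu : 0 < t₁ - 2 := by linarith
  have hv : 0 < t₁ - 1 := by linarith
  have h0 : 0 < t₁ := by linarith
  have hp : 0 < t₁ ^ 2 - 4 * t₁ + 5 := by nlinarith [sq_nonneg (t₁ - 2)]
  have hr : 0 < t₁ ^ 2 - 2 * t₁ + 3 := by linarith
  have e1 : heron a₁ b₁ c₁ =
      4 * (a₁ + b₁ + c₁) ^ 2 * (2 * (t₁ ^ 2 - 2 * t₁ - 1)) ^ 2 := by
    subst ha₁ hb₁ hc₁; unfold heron; ring
  have e2 : heron a₂ b₂ c₂ =
      4 * (a₂ + b₂ + c₂) ^ 2 * (2 * (t₁ ^ 2 - 2 * t₁ - 1)) ^ 2 := by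
    subst ha₂ hb₂ hc₂; unfold heron; ring
  refine ⟨⟨?_, ?_, ?_, ?_, ?_, ?_⟩, ⟨?_, ?_, ?_, ?_, ?_, ?_⟩,
    ⟨2 * (a₁ + b₁ + c₁) * (2 * (t₁ ^ 2 - 2 * t₁ - 1)), by rw [e1]; ring⟩,
    ⟨2 * (a₂ + b₂ + c₂) * (2 * (t₁ ^ 2 - 2 * t₁ - 1)), by rw [e2]; ring⟩, ?_, ?_, e1, e2, ?_⟩
  · rw [ha₁]; positivity
  · rw [hb₁]; positivity
  · rw [hc₁]; positivity
  · have : a₁ + b₁ - c₁ = 8 * (t₁ - 1) := by subst ha₁ hb₁ hc₁; ring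
    linarith
  · have : b₁ + c₁ - a₁ = 4 * (t₁ * (t₁ ^ 2 - 2 * t₁ - 1)) := by subst ha₁ hb₁ hc₁; ring
    have := mul_pos h0 hq
    linarith
  · have : c₁ + a₁ - b₁ = 4 * ((t₁ - 2) * (t₁ ^ 2 - 2 * t₁ - 1)) := by subst ha₁ hb₁ hc₁; ring
    have := mul_pos hu hq
    linarith
  · rw [ha₂]; positivity
  · rw [hb₂]; positivity
  · rw [hc₂]; positivity
  · have : a₂ + b₂ - c₂ = 2 * ((t₁ - 1) ^ 2 * (t₁ ^ 2 - 2 * t₁ - 1)) := by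
      subst ha₂ hb₂ hc₂; ring
    have := mul_pos (pow_pos hv 2) hq
    linarith
  · have : b₂ + c₂ - a₂ = 4 * (t₁ ^ 2 - 2 * t₁ - 1) := by subst ha₂ hb₂ hc₂; ring
    linarith
  · have : c₂ + a₂ - b₂ = 4 * (t₁ ^ 2 - 2 * t₁ + 3) := by subst ha₂ hb₂ hc₂; ring
    linarith
  · rw [e1]; subst ha₁ hb₁ hc₁; ring
  · rw [e2]; subst ha₂ hb₂ hc₂; ring
  · subst ha₂ hb₂ hc₂; ring
end

section
/- Let t be a rational number such that t⁸ − 8t⁷ + 20t⁶ + 56t⁵ − 26t⁴ − 56t³ + 20t² + 8t + 1 ≠ 0, and set u = (t⁸ + 8t⁷ + 20t⁶ − 56t⁵ − 26t⁴ + 56t³ + 20t² − 8t + 1)/(t⁸ − 8t⁷ + 20t⁶ + 56t⁵ − 26t⁴ − 56t³ + 20t² + 8t + 1). Then there exists a rational number v such that −(t+1)²(t−1)²t²·u⁴ + (t²+2t−1)(t²−2t−1)(t−1)(t+1)t·u³ + 6(t+1)²(t−1)²t²·u² − (t²+2t−1)(t²−2t−1)(t−1)(t+1)t·u − (t+1)²(t−1)²t²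 = v². -/
/-- Fermat's method applied at `u = 1` produces a value of `u` making the quartic
(whose square-ness expresses the rationality of the common area) a rational square:
for rational `t` with the denominator nonzero and
`u = (t⁸+8t⁷+20t⁶-56t⁵-26t⁴+56t³+20t²-8t+1)/(t⁸-8t⁷+20t⁶+56t⁵-26t⁴-56t³+20t²+8t+1)`,
there is a rational `v` with
`-(t+1)²(t-1)²t²u⁴ + (t²+2t-1)(t²-2t-1)(t-1)(t+1)t·u³ + 6(t+1)²(t-1)²t²u²
 - (t²+2t-1)(t²-2t-1)(t-1)(t+1)t·u - (t+1)²(t-1)²t² = v²`. -/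
theorem fermat_method_quartic_square (t u : ℚ)
    (hden : t ^ 8 - 8 * t ^ 7 + 20 * t ^ 6 + 56 * t ^ 5 - 26 * t ^ 4 - 56 * t ^ 3 +
      20 * t ^ 2 + 8 * t + 1 ≠ 0)
    (hu : u = (t ^ 8 + 8 * t ^ 7 + 20 * t ^ 6 - 56 * t ^ 5 - 26 * t ^ 4 + 56 * t ^ 3 +
        20 * t ^ 2 - 8 * t + 1) /
      (t ^ 8 - 8 * t ^ 7 + 20 * t ^ 6 + 56 * t ^ 5 - 26 * t ^ 4 - 56 * t ^ 3 +
        20 * t ^ 2 + 8 * t + 1)) :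
    ∃ v : ℚ,
      -((t + 1) ^ 2 * (t - 1) ^ 2 * t ^ 2) * u ^ 4 +
        (t ^ 2 + 2 * t - 1) * (t ^ 2 - 2 * t - 1) * (t - 1) * (t + 1) * t * u ^ 3 +
        6 * (t + 1) ^ 2 * (t - 1) ^ 2 * t ^ 2 * u ^ 2 -
        (t ^ 2 + 2 * t - 1) * (t ^ 2 - 2 * t - 1) * (t - 1) * (t + 1) * t * u -
        (t + 1) ^ 2 * (t - 1) ^ 2 * t ^ 2 = v ^ 2 := by
  refine ⟨(6 * t - 150 * t ^ 3 - 584 * t ^ 5 + 3304 * t ^ 7 - 4460 * t ^ 9 + 4460 * t ^ 11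
    - 3304 * t ^ 13 + 584 * t ^ 15 + 150 * t ^ 17 - 6 * t ^ 19) /
    (t ^ 8 - 8 * t ^ 7 + 20 * t ^ 6 + 56 * t ^ 5 - 26 * t ^ 4 - 56 * t ^ 3 +
      20 * t ^ 2 + 8 * t + 1) ^ 2, ?_⟩
  have hN := (eq_div_iff hden).mp hu
  clear hu
  generalize hD : t ^ 8 - 8 * t ^ 7 + 20 * t ^ 6 + 56 * t ^ 5 - 26 * t ^ 4 - 56 * t ^ 3 +
      20 * t ^ 2 + 8 * t + 1 = D at *
  generalize hM : t ^ 8 + 8 * t ^ 7 + 20 * t ^ 6 - 56 * t ^ 5 - 26 * t ^ 4 + 56 * t ^ 3 +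
        20 * t ^ 2 - 8 * t + 1 = N at *
  rw [div_pow, eq_div_iff (by positivity)]
  have h : -((t + 1) ^ 2 * (t - 1) ^ 2 * t ^ 2) * N ^ 4 +
        (t ^ 2 + 2 * t - 1) * (t ^ 2 - 2 * t - 1) * (t - 1) * (t + 1) * t * N ^ 3 * D +
        6 * (t + 1) ^ 2 * (t - 1) ^ 2 * t ^ 2 * N ^ 2 * D ^ 2 -
        (t ^ 2 + 2 * t - 1) * (t ^ 2 - 2 * t - 1) * (t - 1) * (t + 1) * t * N * D ^ 3 -
        (t + 1) ^ 2 * (t - 1) ^ 2 * t ^ 2 * D ^ 4 =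
      (6 * t - 150 * t ^ 3 - 584 * t ^ 5 + 3304 * t ^ 7 - 4460 * t ^ 9 + 4460 * t ^ 11
    - 3304 * t ^ 13 + 584 * t ^ 15 + 150 * t ^ 17 - 6 * t ^ 19) ^ 2 := by
    rw [← hM, ← hD]
    ring
  rw [← h, ← hN]
  ring
end

section
/- In ℚ[t], define a₁ = 2t(t⁴−2t²+5)(5t⁴−2t²+1)(t⁸+8t⁷+20t⁶−56t⁵−26t⁴+56t³+20t²−8t+1), b₁ = (t−1)(t+1)(t⁴−4t³+10t²−4t+1)(t⁴+4t³+10t²+4t+1)(t⁸−8t⁷+20t⁶+56t⁵−26t⁴−56t³+20t²+8t+1), c₁ = (t²+1)(t¹⁶+104t¹⁴−548t¹²+3032t¹⁰−4922t⁸+3032t⁶−548t⁴+104t²+1), a₂ = (t−1)(t+1)(t⁴−4t³+10t²−4t+1)(t⁴+4t³+10t²+4t+1)(t⁸+8t⁷+20t⁶−56t⁵−26t⁴+56t³+20t²−8t+1), b₂ = 2t(t⁴−2t²+5)(5t⁴−2t²+1)(t⁸−8t⁷+20t⁶+56t⁵−26t⁴−56t³+20t²+8t+1), c₂ = c₁.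 Then the following polynomial identities hold: (i) a₁b₁c₁ = a₂b₂c₂; (ii) H(a₁,b₁,c₁) = H(a₂,b₂,c₂) = 16·A², where A = t(t−1)(t+1)(3t⁴−6t²−1)(t⁴+6t²−3)(t⁴−4t³−6t²−4t+1)(t⁴+4t³−6t²+4t+1)(t¹⁶+104t¹⁴−548t¹²+3032t¹⁰−4922t⁸+3032t⁶−548t⁴+104t²+1); (iii) D²·(aᵢbᵢcᵢ)² = N²·H(aᵢ,bᵢ,cᵢ) for i = 1, 2, where D = 2(3t⁴−6t²−1)(t⁴+6t²−3)(t⁴−4t³−6t²−4t+1)(t⁴+4t³−6t²+4t+1) and N = (t²+1)(t⁴−2t²+5)(5t⁴−2t²+1)(t⁴−4t³+10t²−4t+1)(t⁴+4t³+10t²+4t+1)(t⁸+8t⁷+20t⁶−56t⁵−26t⁴+56t³+20t²−8t+1)(t⁸−8t⁷+20t⁶+56t⁵−26t⁴−56t³+20t²+8t+1); consequently the two triangles have the common area A and the common circumradius N/D. -/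
theorem aux_swap (t x y u v w z p q c : ℚ) :
    (2 * t * x * y * p) * (u * v * w * z * q) * c =
    (u * v * w * z * p) * (2 * t * x * y * q) * c := by ring

theorem aux_rad (t x y u v w z p q k s d e f g : ℚ) :
    (2 * d * e * f * g) * ((2 * t * x * y * p) * (u * v * w * z * q) * (k * s)) =
    4 * (k * x * y * w * z * p * q) * (t * u * v * d * e * f * g * s) := by ring


/-- The paper's pair of triangles with a common circumradius and a common area:
(i) the products of the sides agree; (ii) the Heron products agree and equal `16A²`
where `A` is the explicit common area; (iii) `D²(aᵢbᵢcᵢ)² = N²·H(aᵢ,bᵢ,cᵢ)` for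
`i = 1, 2`, so both triangles have the common circumradius `N/D`. -/
theorem common_circumradius_and_area_pair (t a₁ b₁ c₁ a₂ b₂ c₂ A D N : ℚ)
    (ha₁ : a₁ = 2 * t * (t ^ 4 - 2 * t ^ 2 + 5) * (5 * t ^ 4 - 2 * t ^ 2 + 1) *
      (t ^ 8 + 8 * t ^ 7 + 20 * t ^ 6 - 56 * t ^ 5 - 26 * t ^ 4 + 56 * t ^ 3 +
        20 * t ^ 2 - 8 * t + 1))
    (hb₁ : b₁ = (t - 1) * (t + 1) * (t ^ 4 - 4 * t ^ 3 + 10 * t ^ 2 - 4 * t + 1) *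
      (t ^ 4 + 4 * t ^ 3 + 10 * t ^ 2 + 4 * t + 1) *
      (t ^ 8 - 8 * t ^ 7 + 20 * t ^ 6 + 56 * t ^ 5 - 26 * t ^ 4 - 56 * t ^ 3 +
        20 * t ^ 2 + 8 * t + 1))
    (hc₁ : c₁ = (t ^ 2 + 1) *
      (t ^ 16 + 104 * t ^ 14 - 548 * t ^ 12 + 3032 * t ^ 10 - 4922 * t ^ 8 +
        3032 * t ^ 6 - 548 * t ^ 4 + 104 * t ^ 2 + 1))
    (ha₂ : a₂ = (t - 1) * (t + 1) * (t ^ 4 - 4 * t ^ 3 + 10 * t ^ 2 - 4 * t + 1) *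
      (t ^ 4 + 4 * t ^ 3 + 10 * t ^ 2 + 4 * t + 1) *
      (t ^ 8 + 8 * t ^ 7 + 20 * t ^ 6 - 56 * t ^ 5 - 26 * t ^ 4 + 56 * t ^ 3 +
        20 * t ^ 2 - 8 * t + 1))
    (hb₂ : b₂ = 2 * t * (t ^ 4 - 2 * t ^ 2 + 5) * (5 * t ^ 4 - 2 * t ^ 2 + 1) *
      (t ^ 8 - 8 * t ^ 7 + 20 * t ^ 6 + 56 * t ^ 5 - 26 * t ^ 4 - 56 * t ^ 3 +
        20 * t ^ 2 + 8 * t + 1))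
    (hc₂ : c₂ = c₁)
    (hA : A = t * (t - 1) * (t + 1) * (3 * t ^ 4 - 6 * t ^ 2 - 1) *
      (t ^ 4 + 6 * t ^ 2 - 3) * (t ^ 4 - 4 * t ^ 3 - 6 * t ^ 2 - 4 * t + 1) *
      (t ^ 4 + 4 * t ^ 3 - 6 * t ^ 2 + 4 * t + 1) *
      (t ^ 16 + 104 * t ^ 14 - 548 * t ^ 12 + 3032 * t ^ 10 - 4922 * t ^ 8 +
        3032 * t ^ 6 - 548 * t ^ 4 + 104 * t ^ 2 + 1))
    (hD : D = 2 * (3 * t ^ 4 - 6 * t ^ 2 - 1) * (t ^ 4 + 6 * t ^ 2 - 3) *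
      (t ^ 4 - 4 * t ^ 3 - 6 * t ^ 2 - 4 * t + 1) *
      (t ^ 4 + 4 * t ^ 3 - 6 * t ^ 2 + 4 * t + 1))
    (hN : N = (t ^ 2 + 1) * (t ^ 4 - 2 * t ^ 2 + 5) * (5 * t ^ 4 - 2 * t ^ 2 + 1) *
      (t ^ 4 - 4 * t ^ 3 + 10 * t ^ 2 - 4 * t + 1) *
      (t ^ 4 + 4 * t ^ 3 + 10 * t ^ 2 + 4 * t + 1) *
      (t ^ 8 + 8 * t ^ 7 + 20 * t ^ 6 - 56 * t ^ 5 - 26 * t ^ 4 + 56 * t ^ 3 +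
        20 * t ^ 2 - 8 * t + 1) *
      (t ^ 8 - 8 * t ^ 7 + 20 * t ^ 6 + 56 * t ^ 5 - 26 * t ^ 4 - 56 * t ^ 3 +
        20 * t ^ 2 + 8 * t + 1)) :
    a₁ * b₁ * c₁ = a₂ * b₂ * c₂ ∧
    heron a₁ b₁ c₁ = 16 * A ^ 2 ∧ heron a₂ b₂ c₂ = 16 * A ^ 2 ∧
    D ^ 2 * (a₁ * b₁ * c₁) ^ 2 = N ^ 2 * heron a₁ b₁ c₁ ∧
    D ^ 2 * (a₂ * b₂ * c₂) ^ 2 = N ^ 2 * heron a₂ b₂ c₂ := by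
  have h1 : heron a₁ b₁ c₁ = 16 * A ^ 2 := by
    subst ha₁ hb₁ hc₁ hA
    unfold heron
    ring
  have h2 : heron a₂ b₂ c₂ = 16 * A ^ 2 := by
    subst hc₂ ha₂ hb₂ hc₁ hA
    unfold heron
    ring
  have h3 : a₁ * b₁ * c₁ = a₂ * b₂ * c₂ := by
    rw [ha₁, hb₁, ha₂, hb₂, hc₂]
    exact aux_swap _ _ _ _ _ _ _ _ _ _
  have h4 : D * (a₁ * b₁ * c₁) = 4 * N * A := by
    rw [hD, ha₁, hb₁, hc₁, hN, hA]
    exact aux_rad _ _ _ _ _ _ _ _ _ _ _ _ _ _ _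
  have h5 : D ^ 2 * (a₁ * b₁ * c₁) ^ 2 = N ^ 2 * (16 * A ^ 2) := by
    rw [← mul_pow, h4]
    ring
  refine ⟨h3, h1, h2, ?_, ?_⟩
  · rw [h1, h5]
  · rw [h2, ← h3, h5]
end
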